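/- Hardy–Littlewood–Sobolev inequality: Let n ≥ 1, let r, q > 1 and 0 < μ < n satisfy 1/r + 1/q + μ/n = 2. Then there exists a constant C = C(r, q, n, μ) ≥ 0 such that for all g ∈ L^r(ℝ^n) and h ∈ L^q(ℝ^n), the double integral ∫_{ℝ^n} ∫_{ℝ^n} |g(x)| |h(y)| / ‖x − y‖^μ dx dy is at most C ‖g‖_{L^r} ‖h‖_{L^q}. -/

import Mathlib

open MeasureTheory ENNReal

lemma hls_pw (a b l F H K : ℝ) (ha : 0 < a) (hb : 0 < b) (hl : 0 < l) (ha1 : a < 1) (hb1 : b < 1)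
    (hs : a + b + l = 2) (hF : 0 ≤ F) (hH : 0 ≤ H) (hK : 0 ≤ K) :
    F ^ a * H ^ b * K ^ l ≤ F * H + H ^ b * (min H K ^ a * K ^ l) + F ^ a * (min F K ^ b * K ^ l) := by
  have p1 : 0 ≤ F * H := by positivity
  have p2 : 0 ≤ H ^ b * (min H K ^ a * K ^ l) := by positivity
  have p3 : 0 ≤ F ^ a * (min F K ^ b * K ^ l) := by positivity
  by_cases h1 : F ≤ min H K
  · have : F ^ a ≤ min H K ^ a := Real.rpow_le_rpow hF h1 ha.le
    have : F ^ a * (H ^ b * K ^ l) ≤ min H K ^ a * (H ^ b * K ^ l) :=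
      mul_le_mul_of_nonneg_right this (by positivity)
    linarith
  by_cases h2 : H ≤ min F K
  · have : H ^ b ≤ min F K ^ b := Real.rpow_le_rpow hH h2 hb.le
    have : H ^ b * (F ^ a * K ^ l) ≤ min F K ^ b * (F ^ a * K ^ l) :=
      mul_le_mul_of_nonneg_right this (by positivity)
    linarith
  have hKF : K ≤ F := by
    by_contra hc
    rw [le_min_iff] at h1 h2
    grind
  have hKH : K ≤ H := by
    by_contra hc
    rw [le_min_iff] at h1 h2
    grind
  rcases hK.eq_or_lt with rfl | hK0
  · rw [Real.zero_rpow hl.ne']; simp only [mul_zero]; simpa using p1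
  have hF0 : 0 < F := hK0.trans_le hKF
  have hH0 : 0 < H := hK0.trans_le hKH
  have e : K ^ l = K ^ (1 - a) * K ^ (1 - b) := by
    rw [← Real.rpow_add hK0]; congr 1; linarith
  have e1 : K ^ (1 - a) ≤ F ^ (1 - a) := Real.rpow_le_rpow hK hKF (by linarith)
  have e2 : K ^ (1 - b) ≤ H ^ (1 - b) := Real.rpow_le_rpow hK hKH (by linarith)
  have e3 : F ^ a * F ^ (1 - a) = F := by rw [← Real.rpow_add hF0]; simp
  have e4 : H ^ b * H ^ (1 - b) = H := by rw [← Real.rpow_add hH0]; simp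
  have : F ^ a * H ^ b * K ^ l ≤ F ^ a * H ^ b * (F ^ (1 - a) * H ^ (1 - b)) := by
    rw [e]; gcongr
  have e5 : F ^ a * H ^ b * (F ^ (1 - a) * H ^ (1 - b)) = F * H := by
    calc _ = (F ^ a * F ^ (1 - a)) * (H ^ b * H ^ (1 - b)) := by ring
      _ = _ := by rw [e3, e4]
  linarith

lemma hls_J (n : ℕ) (hn : 1 ≤ n) (a l : ℝ) (ha : 0 < a) (hl : 0 < l) (hl1 : l < 1) (hal : 1 < a + l) :
    Integrable (fun z : EuclideanSpace ℝ (Fin n) => min 1 ((‖z‖ ^ n)⁻¹) ^ a * ((‖z‖ ^ n)⁻¹) ^ l) := by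
  have : Nonempty (Fin n) := ⟨⟨0, hn⟩⟩
  have hn0 : (0:ℝ) < n := by exact_mod_cast hn
  have := (integrable_fun_norm_addHaar (volume : Measure (EuclideanSpace ℝ (Fin n)))
    (f := fun t : ℝ => min 1 ((t ^ n)⁻¹) ^ a * ((t ^ n)⁻¹) ^ l)).2
  apply this
  rw [finrank_euclideanSpace_fin, ← Set.Ioc_union_Ioi_eq_Ioi (zero_le_one' ℝ)]
  apply IntegrableOn.union
  · have h1 : IntegrableOn (fun t : ℝ => t ^ ((n:ℝ) - 1 - n * l)) (Set.Ioc 0 1) := by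
      rw [← intervalIntegrable_iff_integrableOn_Ioc_of_le zero_le_one]
      apply intervalIntegral.intervalIntegrable_rpow'
      nlinarith
    refine h1.congr_fun (fun t ht => ?_) measurableSet_Ioc
    have ht0 : 0 < t := ht.1
    have : min 1 ((t ^ n)⁻¹) = 1 := min_eq_left ((one_le_inv₀ (by positivity)).2 (pow_le_one₀ ht0.le ht.2))
    simp only [this, Real.one_rpow, one_mul, smul_eq_mul]
    rw [Real.inv_rpow (by positivity), ← Real.rpow_natCast, ← Real.rpow_natCast, ← Real.rpow_mul ht0.le,
      ← Real.rpow_neg ht0.le, ← Real.rpow_add ht0]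
    congr 1; push_cast [hn]; ring
  · have h1 : IntegrableOn (fun t : ℝ => t ^ ((n:ℝ) - 1 - n * (a + l))) (Set.Ioi 1) := by
      apply integrableOn_Ioi_rpow_of_lt _ zero_lt_one
      nlinarith
    refine h1.congr_fun (fun t ht => ?_) measurableSet_Ioi
    have ht1 : 1 < t := ht
    have ht0 : 0 < t := by linarith
    have : min 1 ((t ^ n)⁻¹) = (t ^ n)⁻¹ := min_eq_right (inv_le_one_of_one_le₀ (one_le_pow₀ ht1.le))
    simp only [this, smul_eq_mul]
    rw [← Real.rpow_add (by positivity),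
      Real.inv_rpow (by positivity), ← Real.rpow_natCast, ← Real.rpow_natCast, ← Real.rpow_mul ht0.le,
      ← Real.rpow_neg ht0.le, ← Real.rpow_add ht0]
    congr 1; push_cast [hn]; ring

lemma hls_scale (n : ℕ) (hn : 1 ≤ n) (a l : ℝ) (s : ℝ) (hs : 0 < s) :
    ∫⁻ z : EuclideanSpace ℝ (Fin n), ENNReal.ofReal (min s ((‖z‖ ^ n)⁻¹) ^ a * ((‖z‖ ^ n)⁻¹) ^ l)
      = ENNReal.ofReal (s ^ (a + l - 1)) * 
        ∫⁻ z : EuclideanSpace ℝ (Fin n), ENNReal.ofReal (min 1 ((‖z‖ ^ n)⁻¹) ^ a * ((‖z‖ ^ n)⁻¹) ^ l) := by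
  have hn0 : (n:ℝ) ≠ 0 := by positivity
  set R : ℝ := s ^ (1 / (n:ℝ)) with hR
  have hR0 : 0 < R := by positivity
  have hRn : R ^ n = s := by
    rw [hR, ← Real.rpow_natCast, ← Real.rpow_mul hs.le]; simp [hn0]
  have key := Measure.map_addHaar_smul (volume : Measure (EuclideanSpace ℝ (Fin n))) hR0.ne'
  rw [finrank_euclideanSpace_fin, hRn, abs_of_pos (by positivity)] at key
  set f : EuclideanSpace ℝ (Fin n) → ℝ≥0∞ := fun z => ENNReal.ofReal (min 1 ((‖z‖ ^ n)⁻¹) ^ a * ((‖z‖ ^ n)⁻¹) ^ l) with hf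
  have hfm : Measurable f := by fun_prop
  have h1 : ∫⁻ z, f (R • z) = ENNReal.ofReal s⁻¹ * ∫⁻ z, f z := by
    rw [← lintegral_map hfm (by fun_prop), key, lintegral_smul_measure, smul_eq_mul]
  have h2 : ∀ z : EuclideanSpace ℝ (Fin n), ENNReal.ofReal (min s ((‖z‖ ^ n)⁻¹) ^ a * ((‖z‖ ^ n)⁻¹) ^ l)
      = ENNReal.ofReal (s ^ (a + l)) * f (R • z) := by
    intro z
    rw [hf, ← ENNReal.ofReal_mul (by positivity)]
    congr 1
    simp only [norm_smul, Real.norm_of_nonneg hR0.le, mul_pow, hRn, mul_inv]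
    have e : (‖z‖ ^ n)⁻¹ = s * (s⁻¹ * (‖z‖ ^ n)⁻¹) := by field_simp
    have e0 : 0 ≤ s⁻¹ * (‖z‖ ^ n)⁻¹ := by positivity
    generalize s⁻¹ * (‖z‖ ^ n)⁻¹ = k at *
    rw [e]
    have : min s (s * k) = s * min 1 k := by rw [mul_min_of_nonneg _ _ hs.le, mul_one]
    rw [this, Real.mul_rpow hs.le (by positivity), Real.mul_rpow hs.le (by positivity), Real.rpow_add hs]
    ring
  simp_rw [h2]
  rw [lintegral_const_mul _ (by fun_prop), h1, ← mul_assoc, ← ENNReal.ofReal_mul (by positivity)]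
  congr 2
  rw [Real.rpow_sub hs, Real.rpow_one]; rfl

lemma hls_term (n : ℕ) (hn : 1 ≤ n) (a b l : ℝ) (ha : 0 < a) (hs : a + b + l = 2) (hb : 0 < b)
    (H : EuclideanSpace ℝ (Fin n) → ℝ) (hH : ∀ y, 0 ≤ H y) (y : EuclideanSpace ℝ (Fin n)) :
    ∫⁻ x, ENNReal.ofReal (H y ^ b * (min (H y) ((‖x - y‖ ^ n)⁻¹) ^ a * ((‖x - y‖ ^ n)⁻¹) ^ l))
      ≤ ENNReal.ofReal (H y) * ∫⁻ z : EuclideanSpace ℝ (Fin n),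
          ENNReal.ofReal (min 1 ((‖z‖ ^ n)⁻¹) ^ a * ((‖z‖ ^ n)⁻¹) ^ l) := by
  rcases (hH y).eq_or_lt with h0 | h0
  · rw [← h0, Real.zero_rpow hb.ne']; simp
  have e := lintegral_sub_right_eq_self (μ := (volume : Measure (EuclideanSpace ℝ (Fin n))))
    (fun z => ENNReal.ofReal (H y ^ b * (min (H y) ((‖z‖ ^ n)⁻¹) ^ a * ((‖z‖ ^ n)⁻¹) ^ l))) y
  rw [e]
  simp_rw [ENNReal.ofReal_mul (Real.rpow_nonneg (hH y) b)]
  rw [lintegral_const_mul _ (by fun_prop), hls_scale n hn a l _ h0, ← mul_assoc,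
    ← ENNReal.ofReal_mul (by positivity), ← Real.rpow_add h0]
  have : b + (a + l - 1) = 1 := by linarith
  rw [this, Real.rpow_one]

lemma hls_core (n : ℕ) (hn : 1 ≤ n) (a b l : ℝ) (ha : 0 < a) (hb : 0 < b) (hl : 0 < l)
    (ha1 : a < 1) (hb1 : b < 1) (hl1 : l < 1) (hs : a + b + l = 2) :
    ∃ C : ℝ, 0 ≤ C ∧ ∀ F H : EuclideanSpace ℝ (Fin n) → ℝ, Measurable F → Measurable H →
      (∀ x, 0 ≤ F x) → (∀ x, 0 ≤ H x) →
      ∫⁻ x, ENNReal.ofReal (F x) ≤ 1 → ∫⁻ x, ENNReal.ofReal (H x) ≤ 1 →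
      ∫⁻ x, ∫⁻ y, ENNReal.ofReal (F x ^ a * H y ^ b * ((‖x - y‖ ^ n)⁻¹) ^ l) ≤ ENNReal.ofReal C := by
  have hJ1 := (hls_J n hn a l ha hl hl1 (by linarith)).lintegral_lt_top
  have hJ2 := (hls_J n hn b l hb hl hl1 (by linarith)).lintegral_lt_top
  set J1 := ∫⁻ z : EuclideanSpace ℝ (Fin n),
          ENNReal.ofReal (min 1 ((‖z‖ ^ n)⁻¹) ^ a * ((‖z‖ ^ n)⁻¹) ^ l) with eJ1
  set J2 := ∫⁻ z : EuclideanSpace ℝ (Fin n),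
          ENNReal.ofReal (min 1 ((‖z‖ ^ n)⁻¹) ^ b * ((‖z‖ ^ n)⁻¹) ^ l) with eJ2
  refine ⟨(1 + J1 + J2).toReal, ENNReal.toReal_nonneg, fun F H hFm hHm hF hH iF iH => ?_⟩
  have hfin : 1 + J1 + J2 ≠ ⊤ := by simp [hJ1.ne, hJ2.ne]
  rw [ENNReal.ofReal_toReal hfin]
  set A := fun x y : EuclideanSpace ℝ (Fin n) => ENNReal.ofReal (F x) * ENNReal.ofReal (H y) with hA
  set B := fun x y : EuclideanSpace ℝ (Fin n) => ENNReal.ofReal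
    (H y ^ b * (min (H y) ((‖x - y‖ ^ n)⁻¹) ^ a * ((‖x - y‖ ^ n)⁻¹) ^ l)) with hB
  set D := fun x y : EuclideanSpace ℝ (Fin n) => ENNReal.ofReal
    (F x ^ a * (min (F x) ((‖x - y‖ ^ n)⁻¹) ^ b * ((‖x - y‖ ^ n)⁻¹) ^ l)) with hD
  have mA : Measurable (Function.uncurry A) := by
    simp only [hA, Function.uncurry_def]; fun_prop
  have mB : Measurable (Function.uncurry B) := by
    simp only [hB, Function.uncurry_def]; fun_prop
  have mD : Measurable (Function.uncurry D) := by
    simp only [hD, Function.uncurry_def]; fun_prop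
  calc _ ≤ ∫⁻ x, ∫⁻ y, (A x y + B x y + D x y) := by
        refine lintegral_mono fun x => lintegral_mono fun y => ?_
        simp only [hA, hB, hD]
        have hk : 0 ≤ (‖x - y‖ ^ n)⁻¹ := by positivity
        have := hF x
        have := hH y
        rw [← ENNReal.ofReal_mul (hF x), ← ENNReal.ofReal_add (by positivity) (by positivity),
          ← ENNReal.ofReal_add (by positivity) (by positivity)]
        exact ENNReal.ofReal_le_ofReal (hls_pw a b l _ _ _ ha hb hl ha1 hb1 hs (hF x) (hH y) hk)
    _ = (∫⁻ x, ∫⁻ y, A x y) + (∫⁻ x, ∫⁻ y, B x y) + (∫⁻ x, ∫⁻ y, D x y) := by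
        have m1 : ∀ x, Measurable (A x) := fun x => mA.of_uncurry_left
        have m2 : ∀ x, Measurable (B x) := fun x => mB.of_uncurry_left
        have q1 : Measurable (fun x => ∫⁻ y, A x y) := mA.lintegral_prod_right
        have q2 : Measurable (fun x => ∫⁻ y, B x y) := mB.lintegral_prod_right
        have q3 : Measurable (fun x => (∫⁻ y, A x y) + ∫⁻ y, B x y) := q1.add q2
        rw [← lintegral_add_left q1, ← lintegral_add_left q3]
        refine lintegral_congr fun x => ?_
        have q4 : Measurable (fun y => A x y + B x y) := (m1 x).add (m2 x)
        rw [lintegral_add_left q4, lintegral_add_left (m1 x)]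
    _ ≤ 1 + J1 + J2 := by
        gcongr
        · simp only [hA]
          have : ∀ x, ∫⁻ y, ENNReal.ofReal (F x) * ENNReal.ofReal (H y) ≤ ENNReal.ofReal (F x) := by
            intro x
            rw [lintegral_const_mul _ (by fun_prop)]
            exact mul_le_of_le_one_right (by simp) iH
          exact (lintegral_mono this).trans iF
        · rw [lintegral_lintegral_swap mB.aemeasurable]
          refine (lintegral_mono fun y => hls_term n hn a b l ha hs hb H hH y).trans ?_
          rw [lintegral_mul_const _ (by fun_prop)]
          exact mul_le_of_le_one_left (by simp) iH
        · simp only [hD]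
          refine (lintegral_mono fun y => ?_).trans (b := ∫⁻ y, ENNReal.ofReal (F y) * J2) ?_
          · simp_rw [norm_sub_rev y]
            exact hls_term n hn b a l hb (by linarith) ha F hF y
          rw [lintegral_mul_const _ (by fun_prop)]
          exact mul_le_of_le_one_left (by simp) iF

lemma hls_norm (n : ℕ) (r : ℝ) (hr : 1 < r) (g : EuclideanSpace ℝ (Fin n) → ℝ)
    (hg : MemLp g (ENNReal.ofReal r) volume) (N : ℝ)
    (hN : N = (eLpNorm g (ENNReal.ofReal r) volume).toReal) (hN0 : 0 < N) :
    ∫⁻ x, ENNReal.ofReal ((|g x| / N) ^ r) ≤ 1 := by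
  have hr0 : 0 < r := by linarith
  have e : eLpNorm g (ENNReal.ofReal r) volume = ENNReal.ofReal N := by
    rw [hN, ENNReal.ofReal_toReal hg.2.ne]
  rw [eLpNorm_eq_lintegral_rpow_enorm_toReal (by simpa using hr0) (by simp),
    ENNReal.toReal_ofReal hr0.le] at e
  have e2 : ∫⁻ x, ‖g x‖ₑ ^ r = ENNReal.ofReal (N ^ r) := by
    rw [← ENNReal.ofReal_rpow_of_pos hN0, ← e, ← ENNReal.rpow_mul]; simp [hr0.ne']
  have e3 : ∀ x, ENNReal.ofReal ((|g x| / N) ^ r) = ENNReal.ofReal ((N ^ r)⁻¹) * ‖g x‖ₑ ^ r := by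
    intro x
    rw [Real.div_rpow (abs_nonneg _) hN0.le, div_eq_inv_mul, ENNReal.ofReal_mul (by positivity),
      ← ENNReal.ofReal_rpow_of_nonneg (abs_nonneg _) hr0.le, ← Real.enorm_eq_ofReal_abs]
  simp_rw [e3]
  rw [lintegral_const_mul' _ _ (by simp), e2, ← ENNReal.ofReal_mul (by positivity),
    inv_mul_cancel₀ (by positivity)]
  simp

/-- **Hardy–Littlewood–Sobolev inequality.** -/
theorem hardy_littlewood_sobolev (n : ℕ) (hn : 1 ≤ n) (r q μ : ℝ)
    (hr : 1 < r) (hq : 1 < q) (hμ0 : 0 < μ) (hμn : μ < n)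
    (hsum : 1 / r + 1 / q + μ / n = 2) :
    ∃ C : ℝ, 0 ≤ C ∧ ∀ g h : EuclideanSpace ℝ (Fin n) → ℝ,
      MemLp g (ENNReal.ofReal r) volume → MemLp h (ENNReal.ofReal q) volume →
      (∫⁻ x, ∫⁻ y, ENNReal.ofReal (|g x| * |h y| / ‖x - y‖ ^ μ)) ≤
        ENNReal.ofReal (C * (eLpNorm g (ENNReal.ofReal r) volume).toReal *
          (eLpNorm h (ENNReal.ofReal q) volume).toReal) := by
  have hn0 : (0:ℝ) < n := by exact_mod_cast hn
  have hr0 : 0 < r := by linarith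
  have hq0 : 0 < q := by linarith
  obtain ⟨C, hC, key⟩ := hls_core n hn (1 / r) (1 / q) (μ / n) (by positivity) (by positivity)
    (by positivity) ((div_lt_one hr0).2 hr) ((div_lt_one hq0).2 hq) ((div_lt_one hn0).2 hμn) hsum
  refine ⟨C, hC, ?_⟩
  have main : ∀ g h : EuclideanSpace ℝ (Fin n) → ℝ, Measurable g → Measurable h →
      MemLp g (ENNReal.ofReal r) volume → MemLp h (ENNReal.ofReal q) volume →
      (∫⁻ x, ∫⁻ y, ENNReal.ofReal (|g x| * |h y| / ‖x - y‖ ^ μ)) ≤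
        ENNReal.ofReal (C * (eLpNorm g (ENNReal.ofReal r) volume).toReal *
          (eLpNorm h (ENNReal.ofReal q) volume).toReal) := by
    intro g h mg mh hg hh
    set N := (eLpNorm g (ENNReal.ofReal r) volume).toReal with hN
    set M := (eLpNorm h (ENNReal.ofReal q) volume).toReal with hM
    rcases (ENNReal.toReal_nonneg : 0 ≤ N).eq_or_lt with h0 | hN0
    · have : g =ᵐ[volume] 0 := by
        rw [← eLpNorm_eq_zero_iff hg.1 (ENNReal.ofReal_pos.2 hr0).ne']
        exact ((ENNReal.toReal_eq_zero_iff _).1 h0.symm).resolve_right hg.2.ne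
      rw [lintegral_congr_ae (g := fun _ => 0)]
      · simp
      · filter_upwards [this] with x hx
        simp [hx]
    rcases (ENNReal.toReal_nonneg : 0 ≤ M).eq_or_lt with h0 | hM0
    · have : h =ᵐ[volume] 0 := by
        rw [← eLpNorm_eq_zero_iff hh.1 (ENNReal.ofReal_pos.2 hq0).ne']
        exact ((ENNReal.toReal_eq_zero_iff _).1 h0.symm).resolve_right hh.2.ne
      have : ∀ x, ∫⁻ y, ENNReal.ofReal (|g x| * |h y| / ‖x - y‖ ^ μ) = 0 := by
        intro x
        rw [lintegral_congr_ae (g := fun _ => 0)]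
        · simp
        · filter_upwards [this] with y hy
          simp [hy]
      simp [this]
    have k := key (fun x => (|g x| / N) ^ r) (fun x => (|h x| / M) ^ q)
      (by fun_prop) (by fun_prop) (fun x => by positivity) (fun x => by positivity)
      (hls_norm n r hr g hg N hN hN0) (hls_norm n q hq h hh M hM hM0)
    have e : ∀ x y, ENNReal.ofReal (|g x| * |h y| / ‖x - y‖ ^ μ) = ENNReal.ofReal (N * M) *
        ENNReal.ofReal (((|g x| / N) ^ r) ^ (1 / r) * ((|h y| / M) ^ q) ^ (1 / q) *
          ((‖x - y‖ ^ n)⁻¹) ^ (μ / n)) := by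
      intro x y
      rw [← ENNReal.ofReal_mul (by positivity)]
      congr 1
      rw [← Real.rpow_mul (by positivity), ← Real.rpow_mul (by positivity),
        mul_one_div_cancel hr0.ne', mul_one_div_cancel hq0.ne', Real.rpow_one, Real.rpow_one,
        Real.inv_rpow (by positivity), ← Real.rpow_natCast, ← Real.rpow_mul (norm_nonneg _),
        mul_div_cancel₀ _ hn0.ne']
      have hN1 : N ≠ 0 := hN0.ne'
      have hM1 : M ≠ 0 := hM0.ne'
      clear_value N M
      field_simp
    simp_rw [e]
    simp_rw [lintegral_const_mul' (ENNReal.ofReal (N * M)) _ ENNReal.ofReal_ne_top]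
    calc _ ≤ ENNReal.ofReal (N * M) * ENNReal.ofReal C := by gcongr
      _ = _ := by
        rw [← ENNReal.ofReal_mul (by positivity)]; congr 1; ring
  intro g h hg hh
  obtain ⟨g', mg, eg⟩ := hg.1.aemeasurable
  obtain ⟨h', mh, eh⟩ := hh.1.aemeasurable
  have := main g' h' mg mh (hg.ae_eq eg) (hh.ae_eq eh)
  rw [eLpNorm_congr_ae eg, eLpNorm_congr_ae eh]
  refine le_trans (le_of_eq ?_) this
  refine lintegral_congr_ae ?_
  filter_upwards [eg] with x hx
  refine lintegral_congr_ae ?_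
  filter_upwards [eh] with y hy
  rw [hx, hy]
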